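/- Suppose P_tot < ∑_{i=1}^N (2^{T_i} − 1)/a_i with all a_i > 0, T_i ≥ 0, and not all T_i = 0. Then any minimizer P* of J over the feasible set satisfies ∑_i P_i* = P_tot (the power constraint is tight) and J(P*) > 0. -/

import Mathlib

open Real Finset

theorem case_B_insufficient_power (N : ℕ) (a T : Fin N → ℝ)
    (ha : ∀ i, 0 < a i) (hT : ∀ i, 0 ≤ T i)
    (hTne : ∃ i, T i ≠ 0)
    (Ptot : ℝ) (hPtot : 0 < Ptot)
    (hins : Ptot < ∑ i, (2 ^ T i - 1) / a i)
    (P : Fin N → ℝ) (hP : ∀ i, 0 ≤ P i) (hsum : ∑ i, P i ≤ Ptot)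
    (hopt : ∀ Q : Fin N → ℝ, (∀ i, 0 ≤ Q i) → ∑ i, Q i ≤ Ptot →
      ∑ i, (Real.logb 2 (1 + a i * P i) - T i) ^ 2 ≤
        ∑ i, (Real.logb 2 (1 + a i * Q i) - T i) ^ 2) :
    ∑ i, P i = Ptot ∧
    0 < ∑ i, (Real.logb 2 (1 + a i * P i) - T i) ^ 2 := by
  obtain ⟨i, -, hi⟩ : ∃ i ∈ Finset.univ, P i < (2 ^ T i - 1) / a i :=
    Finset.exists_lt_of_sum_lt (lt_of_le_of_lt hsum hins)
  have hai := ha i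
  have hPi := hP i
  have hlt : Real.logb 2 (1 + a i * P i) < T i := by
    rw [Real.logb_lt_iff_lt_rpow (by norm_num) (by positivity)]
    rw [lt_div_iff₀ hai] at hi
    linarith
  refine ⟨?_, ?_⟩
  · by_contra hne
    have hs : ∑ i, P i < Ptot := lt_of_le_of_ne hsum hne
    obtain ⟨d, hd, hd1, hd2⟩ : ∃ d : ℝ, 0 < d ∧ d ≤ (2 ^ T i - 1) / a i - P i ∧
        d ≤ Ptot - ∑ i, P i :=
      ⟨min ((2 ^ T i - 1) / a i - P i) (Ptot - ∑ i, P i),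
        lt_min (by linarith) (by linarith), min_le_left _ _, min_le_right _ _⟩
    have hQ := hopt (fun j => P j + if j = i then d else 0)
      (fun j => by have := hP j; split_ifs <;> linarith)
      (by rw [Finset.sum_add_distrib]; simp; linarith)
    refine absurd hQ (not_le.mpr ?_)
    apply Finset.sum_lt_sum
    · intro j _
      by_cases hj : j = i
      · subst hj
        simp only [if_true]
        have h1 : Real.logb 2 (1 + a j * P j) ≤ Real.logb 2 (1 + a j * (P j + d)) :=
          Real.logb_le_logb_of_le (by norm_num) (by positivity) (by nlinarith)
        have h2 : Real.logb 2 (1 + a j * (P j + d)) ≤ T j := by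
          rw [Real.logb_le_iff_le_rpow (by norm_num) (by positivity)]
          have : P j + d ≤ (2 ^ T j - 1) / a j := by linarith
          rw [le_div_iff₀ hai] at this
          linarith
        nlinarith
      · simp [hj]
    · refine ⟨i, Finset.mem_univ i, ?_⟩
      simp only [if_true]
      have h1 : Real.logb 2 (1 + a i * P i) < Real.logb 2 (1 + a i * (P i + d)) :=
        Real.logb_lt_logb (by norm_num) (by positivity) (by nlinarith)
      have h2 : Real.logb 2 (1 + a i * (P i + d)) ≤ T i := by
        rw [Real.logb_le_iff_le_rpow (by norm_num) (by positivity)]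
        have : P i + d ≤ (2 ^ T i - 1) / a i := by linarith
        rw [le_div_iff₀ hai] at this
        linarith
      nlinarith
  · apply Finset.sum_pos' (fun j _ => sq_nonneg _)
    exact ⟨i, Finset.mem_univ i, by nlinarith⟩
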